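/- Let Q be the 3-dimensional real Leibniz algebra with bracket determined by [g,f]=e (all other brackets of basis vectors zero). A linear map N : Q → Q is a Nijenhuis operator on Q if and only if its matrix (rows = coordinates of N(e), N(f), N(g) in the basis {e,f,g}) has one of the following forms for real parameters: (1) rows (k₁,0,0), (ℓ₁,ℓ₂,0), (p₁,p₂,k₁) with p₂≠0; (2) rows (k₁,0,0), (ℓ₁,ℓ₂,0), (p₁,0,k₁) with ℓ₂≠k₁; (3) rows (k₁,0,0), (ℓ₁,k₁,ℓ₃), (p₁,0,p₃). -/

import Mathlib

/-- Bracket of the 3-dim real Leibniz algebra with [g,f]=e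
(basis e,f,g ↔ indices 0,1,2). -/
noncomputable def br (x y : Fin 3 → ℝ) : Fin 3 → ℝ :=
  ![x 2 * y 1, 0, 0]

/-- Expansion of `N x` in the images of the standard basis. -/
lemma apply_eq_sum_basis (N : (Fin 3 → ℝ) →ₗ[ℝ] (Fin 3 → ℝ)) (x : Fin 3 → ℝ) :
    N x = x 0 • N ![1,0,0] + x 1 • N ![0,1,0] + x 2 • N ![0,0,1] := by
  rw [← map_smul, ← map_smul, ← map_smul, ← map_add, ← map_add]
  congr 1
  ext i
  fin_cases i <;> simp

lemma eq_vec3 {v : Fin 3 → ℝ} {a b c : ℝ} (h0 : v 0 = a) (h1 : v 1 = b) (h2 : v 2 = c) :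
    v = ![a, b, c] := by
  ext i
  fin_cases i <;> simp [h0, h1, h2]

/-- If `e` is an eigenvector of `N` with eigenvalue `k`, the Nijenhuis identity factors. -/
lemma nijenhuis_iff_of_eigenvector (N : (Fin 3 → ℝ) →ₗ[ℝ] (Fin 3 → ℝ)) {k : ℝ}
    (hN : N ![1,0,0] = ![k,0,0]) (x y : Fin 3 → ℝ) :
    br (N x) (N y) + N (N (br x y)) = N (br (N x) y) + N (br x (N y)) ↔
      (N x 2 - k * x 2) * (N y 1 - k * y 1) = 0 := by
  have hc (c : ℝ) : N ![c, 0, 0] = ![c * k, 0, 0] := by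
    rw [apply_eq_sum_basis, hN]
    simp
  simp only [br, hc]
  constructor
  · intro h
    have h0 := congrFun h 0
    simp at h0
    linear_combination h0
  · intro h
    ext i
    fin_cases i
    · simp
      linear_combination h
    all_goals simp

/-- A Nijenhuis operator maps `e` to a multiple of itself. -/
lemma nijenhuis_eigenvector (N : (Fin 3 → ℝ) →ₗ[ℝ] (Fin 3 → ℝ))
    (h : ∀ x y, br (N x) (N y) + N (N (br x y)) = N (br (N x) y) + N (br x (N y))) :
    N ![1,0,0] = ![N ![1,0,0] 0, 0, 0] := by
  have hc (c : ℝ) : N ![c, 0, 0] = c • N ![1,0,0] := by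
    rw [apply_eq_sum_basis]
    simp
  have hz : (![0, 0, 0] : Fin 3 → ℝ) = 0 := by simp
  have h1 := congrFun (h ![0,0,1] ![1,0,0]) 1
  have h2 := congrFun (h ![1,0,0] ![0,1,0]) 2
  simp [br] at h1 h2
  rw [hc (N ![1,0,0] 1)] at h1
  rw [hc (N ![1,0,0] 2)] at h2
  simp [hz] at h1 h2
  exact eq_vec3 rfl h1 h2


theorem nijenhuis_classification_thm2_8 (N : (Fin 3 → ℝ) →ₗ[ℝ] (Fin 3 → ℝ)) :
    (∀ x y, br (N x) (N y) + N (N (br x y)) = N (br (N x) y) + N (br x (N y)))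
    ↔
    ((∃ k₁ ℓ₁ ℓ₂ p₁ p₂ : ℝ, p₂ ≠ 0 ∧
        N ![1,0,0] = ![k₁,0,0] ∧ N ![0,1,0] = ![ℓ₁,ℓ₂,0] ∧ N ![0,0,1] = ![p₁,p₂,k₁]) ∨
     (∃ k₁ ℓ₁ ℓ₂ p₁ : ℝ, ℓ₂ ≠ k₁ ∧
        N ![1,0,0] = ![k₁,0,0] ∧ N ![0,1,0] = ![ℓ₁,ℓ₂,0] ∧ N ![0,0,1] = ![p₁,0,k₁]) ∨
     (∃ k₁ ℓ₁ ℓ₃ p₁ p₃ : ℝ,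
        N ![1,0,0] = ![k₁,0,0] ∧ N ![0,1,0] = ![ℓ₁,k₁,ℓ₃] ∧ N ![0,0,1] = ![p₁,0,p₃])) := by
  constructor
  · intro h
    have he := nijenhuis_eigenvector N h
    have hfac x y := (nijenhuis_iff_of_eigenvector N he x y).mp (h x y)
    generalize N ![1,0,0] 0 = k at he hfac
    have hff := hfac ![0,1,0] ![0,1,0]
    have hfg := hfac ![0,1,0] ![0,0,1]
    have hgf := hfac ![0,0,1] ![0,1,0]
    have hgg := hfac ![0,0,1] ![0,0,1]
    simp [sub_eq_zero] at hff hfg hgf hgg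
    by_cases hp : N ![0,0,1] 1 = 0
    · by_cases hl : N ![0,1,0] 1 = k
      · exact Or.inr (Or.inr ⟨k, _, _, _, _, he, eq_vec3 rfl hl rfl, eq_vec3 rfl hp rfl⟩)
      · exact Or.inr (Or.inl ⟨k, _, _, _, hl, he, eq_vec3 rfl rfl (hff.resolve_right hl),
          eq_vec3 rfl hp (hgf.resolve_right hl)⟩)
    · exact Or.inl ⟨k, _, _, _, _, hp, he, eq_vec3 rfl rfl (hfg.resolve_right hp),
        eq_vec3 rfl rfl (hgg.resolve_right hp)⟩
  · rintro (⟨k, l₁, l₂, p₁, p₂, -, he, hf, hg⟩ | ⟨k, l₁, l₂, p₁, -, he, hf, hg⟩ |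
      ⟨k, l₁, l₃, p₁, p₃, he, hf, hg⟩) x y <;>
    · rw [nijenhuis_iff_of_eigenvector N he, apply_eq_sum_basis N x, apply_eq_sum_basis N y,
        he, hf, hg]
      simp
      ring_nf
      try simp
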